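/- arXiv:2110.12231 — 2 statements merged into one kernel-verified Lean document; each statement's English description precedes it below -/
import Mathlib

section
/- Let n ≥ 1, let K ∈ ℝ^{n×n} be symmetric positive semidefinite, let σ > 0 and let m ∈ ℝⁿ. Let γ be the n-fold product on ℝⁿ of the Gaussian measure N(0, σ²) on ℝ. Then ∫_{ℝⁿ} [ ½ log det(Iₙ + K/σ²) + (1/(2σ²)) (m + ε)ᵀ (Iₙ + K/σ²)^{−1} (m + ε) − (1/(2σ²)) εᵀ ε ] dγ(ε) = ½ log det(Iₙ + K/σ²) − ½ Tr(Iₙ − (Iₙ + K/σ²)^{−1}) + (1/(2σ²)) mᵀ (Iₙ + K/σ²)^{−1} m. -/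
open Matrix MeasureTheory ProbabilityTheory

section GaussianQuadraticForm

variable {ι : Type*} [Fintype ι]

lemma memLp_two_eval_pi_gaussianReal (v : NNReal) (i : ι) :
    MemLp (fun ε : ι → ℝ => ε i) 2 (Measure.pi fun _ : ι => gaussianReal 0 v) :=
  (memLp_id_gaussianReal 2).comp_measurePreserving
    (measurePreserving_eval (fun _ : ι => gaussianReal 0 v) i)

lemma memLp_two_add_eval_pi_gaussianReal (v : NNReal) (m : ι → ℝ) (i : ι) :
    MemLp (fun ε : ι → ℝ => m i + ε i) 2 (Measure.pi fun _ : ι => gaussianReal 0 v) :=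
  (memLp_const (m i)).add (memLp_two_eval_pi_gaussianReal v i)

lemma integral_eval_pi_gaussianReal (v : NNReal) (i : ι) :
    ∫ ε : ι → ℝ, ε i ∂(Measure.pi fun _ : ι => gaussianReal 0 v) = 0 := by
  rw [integral_comp_eval (μ := fun _ : ι => gaussianReal 0 v) (f := fun x : ℝ => x)
    (by fun_prop), integral_id_gaussianReal]

lemma covariance_eval_pi_gaussianReal [DecidableEq ι] (v : NNReal) (i j : ι) :
    cov[fun ε : ι → ℝ => ε i, fun ε => ε j; Measure.pi fun _ : ι => gaussianReal 0 v]
      = if i = j then (v : ℝ) else 0 := by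
  split_ifs with h
  · subst h
    rw [covariance_self (measurable_pi_apply i).aemeasurable]
    exact ((measurePreserving_eval (fun _ : ι => gaussianReal 0 v) i).variance_fun_comp
        (f := id) (by fun_prop)).trans variance_id_gaussianReal
  · exact ((iIndepFun_pi (μ := fun _ : ι => gaussianReal 0 v) (X := fun _ => id)
      fun _ => aemeasurable_id).indepFun h).covariance_eq_zero
      (memLp_two_eval_pi_gaussianReal v i) (memLp_two_eval_pi_gaussianReal v j)

lemma integral_add_eval_mul_add_eval_pi_gaussianReal [DecidableEq ι] (v : NNReal) (m : ι → ℝ)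
    (i j : ι) :
    ∫ ε : ι → ℝ, (m i + ε i) * (m j + ε j) ∂(Measure.pi fun _ : ι => gaussianReal 0 v)
      = m i * m j + if i = j then (v : ℝ) else 0 := by
  have hint (k : ι) := (memLp_two_eval_pi_gaussianReal v k).integrable one_le_two
  have hL := memLp_two_add_eval_pi_gaussianReal v m
  have hmean (k : ι) :
      ∫ ε : ι → ℝ, m k + ε k ∂(Measure.pi fun _ : ι => gaussianReal 0 v) = m k := by
    rw [integral_add (integrable_const _) (hint k), integral_eval_pi_gaussianReal]
    simp
  have hcov := covariance_eq_sub (hL i) (hL j)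
  simp only [Pi.mul_def, hmean] at hcov
  rw [covariance_const_add_left (hint i), covariance_const_add_right (hint j),
    covariance_eval_pi_gaussianReal] at hcov
  linarith

lemma integrable_quadratic_pi_gaussianReal (v : NNReal) (A : Matrix ι ι ℝ) (m : ι → ℝ) :
    Integrable (fun ε : ι → ℝ => (m + ε) ⬝ᵥ (A *ᵥ (m + ε)))
      (Measure.pi fun _ : ι => gaussianReal 0 v) := by
  have hL := memLp_two_add_eval_pi_gaussianReal v m
  simp only [dotProduct, mulVec, Pi.add_apply]
  exact integrable_finsetSum _ fun i _ => (hL i).integrable_mul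
    (memLp_finsetSum _ fun j _ => (hL j).const_mul (A i j))

lemma integral_quadratic_pi_gaussianReal (v : NNReal) (A : Matrix ι ι ℝ) (m : ι → ℝ) :
    ∫ ε : ι → ℝ, (m + ε) ⬝ᵥ (A *ᵥ (m + ε)) ∂(Measure.pi fun _ : ι => gaussianReal 0 v)
      = m ⬝ᵥ (A *ᵥ m) + v * A.trace := by
  classical
  have hL := memLp_two_add_eval_pi_gaussianReal v m
  have hint (i j : ι) : Integrable (fun ε : ι → ℝ => A i j * ((m i + ε i) * (m j + ε j)))
      (Measure.pi fun _ : ι => gaussianReal 0 v) :=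
    ((hL i).integrable_mul (hL j)).const_mul _
  simp only [dotProduct, mulVec, Pi.add_apply, Finset.mul_sum, mul_left_comm _ (A _ _)]
  rw [integral_finsetSum _ fun i _ => integrable_finsetSum _ fun j _ => hint i j]
  simp_rw [integral_finsetSum _ fun j _ => hint _ j, integral_const_mul,
    integral_add_eval_mul_add_eval_pi_gaussianReal, mul_add, Finset.sum_add_distrib]
  simp [trace, Finset.mul_sum, mul_comm]

end GaussianQuadraticForm

/-- **Expected normalized stochastic complexity of GP regression.**
Averaging the normalized stochastic complexity (as a function of the Gaussian
observation noise `ε ∼ N(0, σ²Iₙ)`, with observations `y = m + ε`) yields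
`½ log det(I + K/σ²) − ½ Tr(I − (I + K/σ²)⁻¹) + (1/(2σ²)) mᵀ(I + K/σ²)⁻¹ m`. -/
theorem statement_1 (n : ℕ) (hn : 1 ≤ n)
    (K : Matrix (Fin n) (Fin n) ℝ) (hK : K.PosSemidef)
    (σ : ℝ) (hσ : 0 < σ) (m : Fin n → ℝ) :
    (∫ ε : Fin n → ℝ,
        ((1 : ℝ) / 2) * Real.log ((1 + (σ ^ 2)⁻¹ • K).det)
          + (1 / (2 * σ ^ 2)) * ((m + ε) ⬝ᵥ ((1 + (σ ^ 2)⁻¹ • K)⁻¹ *ᵥ (m + ε)))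
          - (1 / (2 * σ ^ 2)) * (ε ⬝ᵥ ε)
        ∂(Measure.pi fun _ : Fin n => gaussianReal 0 ((σ ^ 2).toNNReal)))
      = (1 / 2) * Real.log ((1 + (σ ^ 2)⁻¹ • K).det)
        - (1 / 2) * Matrix.trace ((1 : Matrix (Fin n) (Fin n) ℝ) - (1 + (σ ^ 2)⁻¹ • K)⁻¹)
        + (1 / (2 * σ ^ 2)) * (m ⬝ᵥ ((1 + (σ ^ 2)⁻¹ • K)⁻¹ *ᵥ m)) := by
  have hv : (((σ ^ 2).toNNReal : NNReal) : ℝ) = σ ^ 2 := Real.coe_toNNReal _ (sq_nonneg σ)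
  generalize (1 + (σ ^ 2)⁻¹ • K)⁻¹ = A
  have hA := integrable_quadratic_pi_gaussianReal (σ ^ 2).toNNReal A m
  have hI := integrable_quadratic_pi_gaussianReal (σ ^ 2).toNNReal
    (1 : Matrix (Fin n) (Fin n) ℝ) 0
  have hnorm := integral_quadratic_pi_gaussianReal (σ ^ 2).toNNReal
    (1 : Matrix (Fin n) (Fin n) ℝ) 0
  simp only [zero_add, one_mulVec] at hI hnorm
  have hfit : Integrable (fun ε : Fin n → ℝ => ((1 : ℝ) / 2) * Real.log (1 + (σ ^ 2)⁻¹ • K).det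
      + (1 / (2 * σ ^ 2)) * ((m + ε) ⬝ᵥ (A *ᵥ (m + ε))))
      (Measure.pi fun _ : Fin n => gaussianReal 0 (σ ^ 2).toNNReal) :=
    (integrable_const _).add (hA.const_mul _)
  rw [integral_sub hfit (hI.const_mul _),
    integral_add (integrable_const _) (hA.const_mul _), integral_const, integral_const_mul,
    integral_const_mul, integral_quadratic_pi_gaussianReal, hnorm, hv, trace_sub]
  simp only [probReal_univ, one_smul, zero_dotProduct]
  field_simp
  ring
end

section
/- There is an absolute constant C₀ > 0 with the following property. Let (Ω, 𝒜, ρ) be a probability space, let R ≥ 1, and let φ₁,…,φ_R : Ω → ℝ be bounded measurable functions with ∫_Ω φ_p φ_q dρ = δ_{pq} for all 1 ≤ p, q ≤ R. Let d₁,…,d_R > 0, set D = diag(d₁,…,d_R), d_max = max_p d_p and M = max{ Σ_{p=1}^R d_p² ‖φ_p‖_∞², d_max² }. Then for every n ≥ 1 and δ ∈ (0,1), the set of x = (x₁,…,x_n) ∈ Ωⁿ such that the matrix Φ ∈ ℝ^{n×R} with entries Φ_{jp} = φ_p(x_j) satisfies ‖D (Φᵀ Φ − n I_R) D‖₂ ≤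 C₀ max{ √(n d_max² M log(2R/δ)), M log(2R/δ) } has ρ^{⊗n}-measure at least 1 − δ, where ‖·‖₂ is the spectral (operator) norm. -/
open Matrix MeasureTheory

/-- The spectral (l2 operator) norm of a square real matrix. -/
noncomputable def opNorm {k : ℕ} (A : Matrix (Fin k) (Fin k) ℝ) : ℝ :=
  ‖Matrix.toEuclideanCLM (𝕜 := ℝ) A‖

section GoldenThompson

variable {ι : Type*} [Fintype ι]

/-- Cauchy–Schwarz for the trace inner product. -/
lemma sq_trace_mul_le (A B : Matrix ι ι ℝ) :
    (A * B).trace ^ 2 ≤ (A * Aᵀ).trace * (B * Bᵀ).trace := by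
  have h : ∀ C D : Matrix ι ι ℝ,
      (C * D).trace = ∑ p : ι × ι, C p.1 p.2 * D p.2 p.1 := fun C D => by
    simp [Matrix.trace, Matrix.mul_apply, Fintype.sum_prod_type]
  rw [h, Matrix.trace_mul_comm B, h, h]
  refine (Finset.sum_mul_sq_le_sq_mul_sq _ _ _).trans_eq ?_
  simp [sq]

variable [DecidableEq ι]

lemma trace_mul_pow_comm (A B : Matrix ι ι ℝ) (m : ℕ) :
    ((A * B) ^ m).trace = ((B * A) ^ m).trace := by
  cases m with
  | zero => simp
  | succ m =>
    have h : SemiconjBy A (B * A) (A * B) := by simp [SemiconjBy, mul_assoc]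
    rw [pow_succ, ← mul_assoc, ← (h.pow_right m).eq, Matrix.trace_mul_comm, ← mul_assoc,
      ← pow_succ']

/-- The trace inequality `|tr C^(2m)| ≤ tr (C Cᵀ)^m` for `m` a power of two, proved together with
`tr (AB)^m ≤ tr A^m B^m`. -/
lemma abs_trace_pow_le_and_trace_mul_pow_le (k : ℕ) :
    (∀ C : Matrix ι ι ℝ, |(C ^ 2 ^ (k + 1)).trace| ≤ ((C * Cᵀ) ^ 2 ^ k).trace) ∧
    (∀ A B : Matrix ι ι ℝ, A.IsSymm → B.IsSymm →
      ((A * B) ^ 2 ^ k).trace ≤ (A ^ 2 ^ k * B ^ 2 ^ k).trace) := by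
  induction k with
  | zero =>
    refine ⟨fun C => ?_, fun A B _ _ => by simp⟩
    have hnn : 0 ≤ (C * Cᵀ).trace := (Matrix.posSemidef_self_mul_conjTranspose C).trace_nonneg
    have := sq_trace_mul_le C C
    simp only [zero_add, pow_one, pow_zero]
    rw [sq]
    exact abs_le_of_sq_le_sq (by nlinarith) hnn
  | succ k ih =>
    obtain ⟨ih₁, ih₂⟩ := ih
    refine ⟨fun C => ?_, fun A B hA hB => ?_⟩
    · have hP : (Cᵀ * C).IsSymm := by simp [Matrix.IsSymm]
      have hQ : (C * Cᵀ).IsSymm := by simp [Matrix.IsSymm]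
      have h₁ := ih₁ (C ^ 2)
      rw [← pow_mul, ← pow_succ'] at h₁
      refine h₁.trans ?_
      have e : ((C ^ 2 * (C ^ 2)ᵀ) ^ 2 ^ k).trace = ((Cᵀ * C * (C * Cᵀ)) ^ 2 ^ k).trace := by
        rw [show C ^ 2 * (C ^ 2)ᵀ = (C * C * Cᵀ) * Cᵀ by
          simp [sq, Matrix.transpose_mul, mul_assoc], trace_mul_pow_comm]
        simp [mul_assoc]
      rw [e]
      refine (ih₂ _ _ hP hQ).trans ?_
      set U := (Cᵀ * C) ^ 2 ^ k
      set V := (C * Cᵀ) ^ 2 ^ k with hV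
      have hU : U * Uᵀ = (Cᵀ * C) ^ 2 ^ (k + 1) := by
        rw [Matrix.transpose_pow, hP.eq, ← pow_add]; congr 1; ring
      have hVV : V * Vᵀ = (C * Cᵀ) ^ 2 ^ (k + 1) := by
        rw [Matrix.transpose_pow, hQ.eq, ← pow_add]; congr 1; ring
      have hcs := sq_trace_mul_le U V
      have hnn : 0 ≤ (V * Vᵀ).trace := (Matrix.posSemidef_self_mul_conjTranspose V).trace_nonneg
      rw [hU, trace_mul_pow_comm, ← hVV] at hcs
      rw [← hVV]
      exact (abs_le_of_sq_le_sq' (by nlinarith) hnn).2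
    · refine (le_abs_self _).trans ((ih₁ (A * B)).trans ?_)
      have e : ((A * B * (A * B)ᵀ) ^ 2 ^ k).trace = ((A ^ 2 * B ^ 2) ^ 2 ^ k).trace := by
        rw [show A * B * (A * B)ᵀ = (A * B * B) * A by
          simp [Matrix.transpose_mul, hA.eq, hB.eq, mul_assoc], trace_mul_pow_comm]
        simp [sq, mul_assoc]
      rw [e]
      have := ih₂ (A ^ 2) (B ^ 2) (hA.pow 2) (hB.pow 2)
      rwa [← pow_mul, ← pow_mul, ← pow_succ'] at this

lemma norm_pow_sub_pow_le_nat_mul {𝔸 : Type*} [NormedRing 𝔸] [NormOneClass 𝔸] {P Q : 𝔸} {M : ℝ}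
    (hM : 1 ≤ M) (hP : ‖P‖ ≤ M) (hQ : ‖Q‖ ≤ M) (n : ℕ) :
    ‖P ^ n - Q ^ n‖ ≤ M ^ n * (n * ‖P - Q‖) := by
  induction n with
  | zero => simp
  | succ n ih =>
    have e : P ^ (n + 1) - Q ^ (n + 1) = P ^ n * (P - Q) + (P ^ n - Q ^ n) * Q := by
      simp only [pow_succ]; noncomm_ring
    have h₁ : ‖P ^ n‖ ≤ M ^ n := (norm_pow_le _ _).trans (by gcongr)
    have h₂ : M ^ n ≤ M ^ (n + 1) := pow_le_pow_right₀ hM n.le_succ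
    calc ‖P ^ (n + 1) - Q ^ (n + 1)‖ ≤ ‖P ^ n‖ * ‖P - Q‖ + ‖P ^ n - Q ^ n‖ * ‖Q‖ := by
          rw [e]
          exact (norm_add_le _ _).trans (add_le_add (norm_mul_le _ _) (norm_mul_le _ _))
      _ ≤ M ^ (n + 1) * ‖P - Q‖ + M ^ n * (n * ‖P - Q‖) * M := by gcongr; exact h₁.trans h₂
      _ = M ^ (n + 1) * ((n + 1 : ℕ) * ‖P - Q‖) := by push_cast; ring

open Filter Topology Asymptotics in
/-- The **Lie–Trotter product formula**. -/
lemma tendsto_exp_mul_exp_pow {𝔸 : Type*} [NormedRing 𝔸] [NormOneClass 𝔸] [NormedAlgebra ℝ 𝔸]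
    [CompleteSpace 𝔸] (A B : 𝔸) :
    Tendsto (fun n : ℕ => (NormedSpace.exp ((n : ℝ)⁻¹ • A) * NormedSpace.exp ((n : ℝ)⁻¹ • B)) ^ n)
      atTop (𝓝 (NormedSpace.exp (A + B))) := by
  let _ : NormedAlgebra ℚ 𝔸 := NormedAlgebra.restrictScalars ℚ ℝ 𝔸
  set f : ℝ → 𝔸 := fun t => NormedSpace.exp (t • A) * NormedSpace.exp (t • B) with hf
  set g : ℝ → 𝔸 := fun t => NormedSpace.exp (t • (A + B)) with hg
  have hf0 : f 0 = 1 := by simp [hf]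
  have hg0 : g 0 = 1 := by simp [hg]
  have dg : HasDerivAt g (A + B) 0 := 
    (hasDerivAt_exp_smul_const (𝕂 := ℝ) (A + B) (0 : ℝ)).congr_deriv (by simp)
  have df : HasDerivAt f (A + B) 0 := 
    ((hasDerivAt_exp_smul_const (𝕂 := ℝ) A (0 : ℝ)).mul
      (hasDerivAt_exp_smul_const (𝕂 := ℝ) B (0 : ℝ))).congr_deriv (by simp)
  have hinv : Tendsto (fun n : ℕ => (n : ℝ)⁻¹) atTop (𝓝 0) := tendsto_inv_atTop_nhds_zero_nat
  have bound : ∀ F : ℝ → 𝔸, F 0 = 1 → HasDerivAt F (A + B) 0 →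
      ∃ K : ℝ, 0 ≤ K ∧ ∀ᶠ n : ℕ in atTop, ‖F (n : ℝ)⁻¹‖ ≤ 1 + K * (n : ℝ)⁻¹ := by
    intro F hF0 dF
    obtain ⟨K, hK, hb⟩ := dF.differentiableAt.isBigO_sub.exists_nonneg
    refine ⟨K, hK, ?_⟩
    filter_upwards [hinv.eventually hb.bound] with n hn
    have hpos : (0 : ℝ) ≤ (n : ℝ)⁻¹ := by positivity
    rw [hF0, sub_zero, Real.norm_of_nonneg hpos] at hn
    calc ‖F (n : ℝ)⁻¹‖ = ‖(1 : 𝔸) + (F (n : ℝ)⁻¹ - 1)‖ := by congr 1; abel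
      _ ≤ 1 + K * (n : ℝ)⁻¹ := (norm_add_le _ _).trans (by rw [norm_one]; gcongr)
  obtain ⟨K₁, hK₁, h₁⟩ := bound f hf0 df
  obtain ⟨K₂, hK₂, h₂⟩ := bound g hg0 dg
  have hlim : Tendsto (fun n : ℕ => (n : ℝ) * ‖f (n : ℝ)⁻¹ - g (n : ℝ)⁻¹‖) atTop (𝓝 0) := by
    have hd : HasDerivAt (fun t => f t - g t) 0 0 := (df.sub dg).congr_deriv (sub_self _)
    have ho := (hasDerivAt_iff_isLittleO.1 hd).comp_tendsto hinv
    simp only [hf0, hg0, sub_self, sub_zero, smul_zero, Function.comp_def] at ho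
    simpa [div_eq_mul_inv, mul_comm] using ho.norm_left.tendsto_div_nhds_zero
  have hsub : Tendsto (fun n : ℕ => f (n : ℝ)⁻¹ ^ n - g (n : ℝ)⁻¹ ^ n) atTop (𝓝 0) := by
    refine squeeze_zero_norm' ?_ (by simpa using hlim.const_mul (Real.exp (K₁ + K₂)))
    filter_upwards [h₁, h₂, eventually_gt_atTop 0] with n hn₁ hn₂ hn
    have hn' : (0 : ℝ) < n := by exact_mod_cast hn
    have hp : 0 ≤ (n : ℝ)⁻¹ := by positivity
    refine (norm_pow_sub_pow_le_nat_mul (M := 1 + (K₁ + K₂) * (n : ℝ)⁻¹)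
      (by nlinarith [mul_nonneg (add_nonneg hK₁ hK₂) hp]) (by nlinarith [mul_nonneg hK₂ hp])
      (by nlinarith [mul_nonneg hK₁ hp]) n).trans ?_
    gcongr
    calc (1 + (K₁ + K₂) * (n : ℝ)⁻¹) ^ n ≤ (Real.exp ((K₁ + K₂) * (n : ℝ)⁻¹)) ^ n := by
          gcongr
          linarith [Real.add_one_le_exp ((K₁ + K₂) * (n : ℝ)⁻¹)]
      _ = Real.exp (K₁ + K₂) := by
          rw [← Real.exp_nat_mul]; congr 1; field_simp
  have hgn : ∀ᶠ n : ℕ in atTop, g (n : ℝ)⁻¹ ^ n = NormedSpace.exp (A + B) := by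
    filter_upwards [eventually_gt_atTop 0] with n hn
    have hn' : (n : ℝ) ≠ 0 := by positivity
    rw [hg, ← NormedSpace.exp_nsmul, ← Nat.cast_smul_eq_nsmul ℝ, smul_smul, mul_inv_cancel₀ hn',
      one_smul]
  have := hsub.add (tendsto_const_nhds (x := NormedSpace.exp (A + B)))
  rw [zero_add] at this
  refine this.congr' ?_
  filter_upwards [hgn] with n hn
  rw [hn]; abel

open Filter Topology in
open scoped Matrix.Norms.L2Operator in
/-- The **Golden–Thompson inequality** for real symmetric matrices. -/
lemma trace_exp_add_le [Nonempty ι] {A B : Matrix ι ι ℝ} (hA : A.IsSymm) (hB : B.IsSymm) :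
    (NormedSpace.exp (A + B)).trace ≤ (NormedSpace.exp A * NormedSpace.exp B).trace := by
  have hpow : Tendsto (fun k : ℕ => 2 ^ k) atTop atTop :=
    tendsto_pow_atTop_atTop_of_one_lt one_lt_two
  have hlim := (tendsto_exp_mul_exp_pow A B).comp hpow
  have htr := ((continuous_id.matrix_trace).tendsto (NormedSpace.exp (A + B))).comp hlim
  refine le_of_tendsto htr (Eventually.of_forall fun k => ?_)
  have hsymm : ∀ {C : Matrix ι ι ℝ}, C.IsSymm → ((((2 ^ k : ℕ) : ℝ)⁻¹) • C).IsSymm :=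
    fun h => h.smul _
  have hexp : ∀ C : Matrix ι ι ℝ,
      NormedSpace.exp ((((2 ^ k : ℕ) : ℝ)⁻¹) • C) ^ 2 ^ k = NormedSpace.exp C := fun C => by
    rw [← Matrix.exp_nsmul, ← Nat.cast_smul_eq_nsmul ℝ, smul_smul,
      mul_inv_cancel₀ (by positivity), one_smul]
  have := (abs_trace_pow_le_and_trace_mul_pow_le k).2 _ _ (hsymm hA).exp (hsymm hB).exp
  rw [hexp, hexp] at this
  simpa using this

end GoldenThompson

section Spectral

variable {ι : Type*} [Fintype ι] [DecidableEq ι]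

lemma Matrix.IsSymm.exists_eq_orthogonal_conj {A : Matrix ι ι ℝ} (hA : A.IsSymm) :
    ∃ U ∈ Matrix.orthogonalGroup ι ℝ, ∃ l : ι → ℝ, A = U * Matrix.diagonal l * Uᵀ := by
  have hA' : A.IsHermitian := by simpa [Matrix.IsHermitian] using hA.eq
  refine ⟨hA'.eigenvectorUnitary, hA'.eigenvectorUnitary.2, hA'.eigenvalues, ?_⟩
  conv_lhs => rw [hA'.spectral_theorem, Unitary.conjStarAlgAut_apply]
  simp [Matrix.star_eq_conjTranspose]

lemma transpose_mul_self_of_mem_orthogonalGroup {U : Matrix ι ι ℝ}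
    (hU : U ∈ Matrix.orthogonalGroup ι ℝ) : Uᵀ * U = 1 := by
  simpa [Matrix.star_eq_conjTranspose] using (Matrix.mem_orthogonalGroup_iff' ι ℝ).1 hU

lemma mul_transpose_self_of_mem_orthogonalGroup {U : Matrix ι ι ℝ}
    (hU : U ∈ Matrix.orthogonalGroup ι ℝ) : U * Uᵀ = 1 := by
  simpa [Matrix.star_eq_conjTranspose] using (Matrix.mem_orthogonalGroup_iff ι ℝ).1 hU

lemma exp_orthogonal_conj {U : Matrix ι ι ℝ} (hU : U ∈ Matrix.orthogonalGroup ι ℝ) (l : ι → ℝ) :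
    NormedSpace.exp (U * Matrix.diagonal l * Uᵀ) =
      U * Matrix.diagonal (fun i => Real.exp (l i)) * Uᵀ := by
  have h := mul_transpose_self_of_mem_orthogonalGroup hU
  have hinv : U⁻¹ = Uᵀ := Matrix.inv_eq_right_inv h
  have hu : IsUnit U := ⟨⟨U, Uᵀ, h, transpose_mul_self_of_mem_orthogonalGroup hU⟩, rfl⟩
  rw [← hinv, Matrix.exp_conj _ _ hu, Matrix.exp_diagonal]
  congr 3
  ext i
  rw [Pi.coe_exp, Real.exp_eq_exp_ℝ]

lemma trace_orthogonal_conj {U : Matrix ι ι ℝ} (hU : U ∈ Matrix.orthogonalGroup ι ℝ)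
    (A : Matrix ι ι ℝ) : (U * A * Uᵀ).trace = A.trace := by
  rw [Matrix.trace_mul_comm, ← mul_assoc, transpose_mul_self_of_mem_orthogonalGroup hU, one_mul]

lemma posSemidef_orthogonal_conj_diagonal (U : Matrix ι ι ℝ) {l : ι → ℝ} (hl : ∀ i, 0 ≤ l i) :
    (U * Matrix.diagonal l * Uᵀ).PosSemidef := by
  simpa using (Matrix.PosSemidef.diagonal (n := ι) (d := l) hl).mul_mul_conjTranspose_same U

lemma Matrix.IsSymm.posSemidef_exp {A : Matrix ι ι ℝ} (hA : A.IsSymm) :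
    (NormedSpace.exp A).PosSemidef := by
  obtain ⟨U, hU, l, rfl⟩ := hA.exists_eq_orthogonal_conj
  rw [exp_orthogonal_conj hU]
  exact posSemidef_orthogonal_conj_diagonal U fun i => (Real.exp_pos _).le

open scoped MatrixOrder Matrix.Norms.L2Operator in
lemma Matrix.PosSemidef.trace_mul_nonneg {A B : Matrix ι ι ℝ} (hA : A.PosSemidef)
    (hB : B.PosSemidef) : 0 ≤ (A * B).trace := by
  obtain ⟨C, rfl⟩ := CStarAlgebra.nonneg_iff_eq_star_mul_self.1 hA.nonneg
  rw [Matrix.star_eq_conjTranspose, mul_assoc, Matrix.trace_mul_comm]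
  exact (hB.mul_mul_conjTranspose_same C).trace_nonneg

/-- The operator inequality `exp X ≤ 1 + X + X²` for `-1 ≤ X ≤ 1`. -/
lemma posSemidef_one_add_add_sq_sub_exp {X : Matrix ι ι ℝ} (hX : X.IsSymm)
    (hb : ∀ v : ι → ℝ, |v ⬝ᵥ X *ᵥ v| ≤ v ⬝ᵥ v) :
    (1 + X + X * X - NormedSpace.exp X).PosSemidef := by
  obtain ⟨U, hU, l, rfl⟩ := hX.exists_eq_orthogonal_conj
  have h₁ := mul_transpose_self_of_mem_orthogonalGroup hU
  have h₂ := transpose_mul_self_of_mem_orthogonalGroup hU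
  have hl : ∀ i, |l i| ≤ 1 := fun i => by
    have h := hb (U *ᵥ Pi.single i 1)
    have e : ∀ v w : ι → ℝ, (U *ᵥ v) ⬝ᵥ (U *ᵥ w) = v ⬝ᵥ w := fun v w => by
      rw [Matrix.dotProduct_mulVec, Matrix.vecMul_mulVec, h₂, Matrix.vecMul_one]
    rw [Matrix.mulVec_mulVec, mul_assoc, h₂, mul_one, ← Matrix.mulVec_mulVec, e, e] at h
    simpa using h
  rw [exp_orthogonal_conj hU]
  have e : 1 + U * Matrix.diagonal l * Uᵀ + U * Matrix.diagonal l * Uᵀ *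
      (U * Matrix.diagonal l * Uᵀ) - U * Matrix.diagonal (fun i => Real.exp (l i)) * Uᵀ =
      U * Matrix.diagonal (fun i => 1 + l i + l i * l i - Real.exp (l i)) * Uᵀ := by
    have e₁ : U * Matrix.diagonal l * Uᵀ * (U * Matrix.diagonal l * Uᵀ) =
        U * (Matrix.diagonal l * Matrix.diagonal l) * Uᵀ := by
      calc _ = U * Matrix.diagonal l * (Uᵀ * U) * Matrix.diagonal l * Uᵀ := by noncomm_ring
        _ = _ := by rw [h₂]; noncomm_ring
    rw [e₁, ← Matrix.diagonal_sub, ← Matrix.diagonal_add, ← Matrix.diagonal_add,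
      ← Matrix.diagonal_mul_diagonal, show (Matrix.diagonal fun _ : ι => (1 : ℝ)) = 1 from
        Matrix.diagonal_one, mul_sub, mul_add, mul_add, sub_mul, add_mul, add_mul, mul_one, h₁]
  rw [e]
  refine posSemidef_orthogonal_conj_diagonal U fun i => ?_
  have := (abs_le.1 (Real.abs_exp_sub_one_sub_id_le (hl i))).2
  nlinarith

open scoped Matrix.Norms.L2Operator in
lemma exp_mul_norm_le_trace_exp_add [Nonempty ι] {A : Matrix ι ι ℝ} (hA : A.IsSymm) {θ : ℝ} :
    Real.exp (θ * ‖A‖) ≤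
      (NormedSpace.exp (θ • A)).trace + (NormedSpace.exp (-θ • A)).trace := by
  obtain ⟨U, hU, l, rfl⟩ := hA.exists_eq_orthogonal_conj
  have htr : ∀ s : ℝ, (NormedSpace.exp (s • (U * Matrix.diagonal l * Uᵀ))).trace =
      ∑ i, Real.exp (s * l i) := fun s => by
    rw [← Matrix.smul_mul, ← Matrix.mul_smul, ← Matrix.diagonal_smul, exp_orthogonal_conj hU,
      trace_orthogonal_conj hU, Matrix.trace_diagonal]
    simp
  have hUt : Uᵀ ∈ unitary (Matrix ι ι ℝ) := by
    simpa [Matrix.star_eq_conjTranspose] using Unitary.star_mem hU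
  obtain ⟨i, -, hi⟩ := Finset.exists_max_image Finset.univ (fun i => ‖l i‖) Finset.univ_nonempty
  have hnorm : ‖U * Matrix.diagonal l * Uᵀ‖ = |l i| := by
    rw [CStarRing.norm_mul_mem_unitary _ hUt, CStarRing.norm_mem_unitary_mul _ hU,
      Matrix.l2_opNorm_diagonal]
    exact le_antisymm ((pi_norm_le_iff_of_nonneg (norm_nonneg _)).2
      fun j => hi j (Finset.mem_univ j)) (norm_le_pi_norm l i)
  have hsum : ∀ s : ℝ, Real.exp (s * l i) ≤ ∑ j, Real.exp (s * l j) := fun s =>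
    Finset.single_le_sum (f := fun j => Real.exp (s * l j)) (fun _ _ => (Real.exp_pos _).le)
      (Finset.mem_univ i)
  rw [hnorm, htr, htr]
  rcases abs_cases (l i) with ⟨h, -⟩ | ⟨h, -⟩
  · rw [h]
    exact (hsum θ).trans (le_add_of_nonneg_right
      (Finset.sum_nonneg fun _ _ => (Real.exp_pos _).le))
  · rw [h, mul_neg, ← neg_mul]
    exact (hsum (-θ)).trans (le_add_of_nonneg_left
      (Finset.sum_nonneg fun _ _ => (Real.exp_pos _).le))

open scoped Matrix.Norms.L2Operator in
lemma measurable_trace_exp {α : Type*} [MeasurableSpace α] {W : α → Matrix ι ι ℝ}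
    (hW : ∀ p q, Measurable fun z => W z p q) :
    Measurable fun z => (NormedSpace.exp (W z)).trace := by
  have hc : Continuous fun f : ι → ι → ℝ => (NormedSpace.exp (Matrix.of f)).trace := by
    let _ : NormedAlgebra ℚ (Matrix ι ι ℝ) := NormedAlgebra.restrictScalars ℚ ℝ _
    exact (NormedSpace.exp_continuous (𝔸 := Matrix ι ι ℝ)).matrix_trace
  exact hc.measurable.comp (measurable_pi_lambda _ fun p => measurable_pi_lambda _ fun q => hW p q)

end Spectral

section Probability

open scoped ENNReal

variable {ι Ω : Type*} [Fintype ι] [MeasurableSpace Ω] {ρ : Measure Ω}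

lemma integrable_trace_mul (G : Matrix ι ι ℝ) {Y : Ω → Matrix ι ι ℝ}
    (hY : ∀ p q, Integrable (fun z => Y z p q) ρ) :
    Integrable (fun z => (G * Y z).trace) ρ := by
  simp only [Matrix.trace, Matrix.diag_apply, Matrix.mul_apply]
  exact integrable_finsetSum _ fun p _ => integrable_finsetSum _ fun q _ =>
    (hY q p).const_mul _

lemma integral_trace_mul (G : Matrix ι ι ℝ) {Y : Ω → Matrix ι ι ℝ} {L : Matrix ι ι ℝ}
    (hY : ∀ p q, Integrable (fun z => Y z p q) ρ) (hL : ∀ p q, ∫ z, Y z p q ∂ρ = L p q) :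
    ∫ z, (G * Y z).trace ∂ρ = (G * L).trace := by
  simp only [Matrix.trace, Matrix.diag_apply, Matrix.mul_apply]
  refine (integral_finsetSum _ fun p _ => integrable_finsetSum _ fun q _ =>
    (hY q p).const_mul _).trans ?_
  refine Finset.sum_congr rfl fun p _ => ?_
  refine (integral_finsetSum _ fun q _ => (hY q p).const_mul _).trans ?_
  exact Finset.sum_congr rfl fun q _ => by rw [integral_const_mul, hL]

variable [DecidableEq ι]

/-- One-step bounds on the exponential trace moment multiply over independent summands. -/
lemma lintegral_trace_exp_add_sum_le [IsProbabilityMeasure ρ] {W : Ω → Matrix ι ι ℝ}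
    (hW : ∀ p q, Measurable fun z => W z p q) (hsymm : ∀ z, (W z).IsSymm) {c : ℝ≥0∞}
    (hstep : ∀ H : Matrix ι ι ℝ, H.IsSymm →
      ∫⁻ z, ENNReal.ofReal (NormedSpace.exp (H + W z)).trace ∂ρ ≤
        c * ENNReal.ofReal (NormedSpace.exp H).trace) (n : ℕ) :
    ∀ H : Matrix ι ι ℝ, H.IsSymm →
      ∫⁻ x, ENNReal.ofReal (NormedSpace.exp (H + ∑ j, W (x j))).trace
          ∂(Measure.pi fun _ : Fin n => ρ) ≤
        c ^ n * ENNReal.ofReal (NormedSpace.exp H).trace := by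
  induction n with
  | zero => intro H _; simp
  | succ n ih =>
    intro H hH
    set G : Ω × (Fin n → Ω) → ℝ≥0∞ := fun y =>
      ENNReal.ofReal (NormedSpace.exp (H + W y.1 + ∑ j, W (y.2 j))).trace with hG
    have hGm : Measurable G := by
      refine (measurable_trace_exp fun p q => ?_).ennreal_ofReal
      simp only [Matrix.add_apply, Matrix.sum_apply]
      exact (((hW p q).comp measurable_fst).const_add _).add
        (Finset.measurable_sum _ fun j _ =>
          (hW p q).comp ((measurable_pi_apply j).comp measurable_snd))
    have hmp := measurePreserving_piFinSuccAbove (fun _ : Fin (n + 1) => ρ) 0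
    calc ∫⁻ x, ENNReal.ofReal (NormedSpace.exp (H + ∑ j, W (x j))).trace
          ∂(Measure.pi fun _ : Fin (n + 1) => ρ)
        = ∫⁻ x, G (MeasurableEquiv.piFinSuccAbove (fun _ => Ω) 0 x)
          ∂(Measure.pi fun _ : Fin (n + 1) => ρ) := by
          refine lintegral_congr fun x => ?_
          simp [hG, Fin.sum_univ_succ, add_assoc, MeasurableEquiv.piFinSuccAbove_apply,
            Fin.tail]
      _ = ∫⁻ y, G y ∂(ρ.prod (Measure.pi fun _ : Fin n => ρ)) := hmp.lintegral_comp hGm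
      _ = ∫⁻ z, ∫⁻ y, G (z, y) ∂(Measure.pi fun _ : Fin n => ρ) ∂ρ :=
          lintegral_prod _ hGm.aemeasurable
      _ ≤ ∫⁻ z, c ^ n * ENNReal.ofReal (NormedSpace.exp (H + W z)).trace ∂ρ :=
          lintegral_mono fun z => ih _ (hH.add (hsymm z))
      _ = c ^ n * ∫⁻ z, ENNReal.ofReal (NormedSpace.exp (H + W z)).trace ∂ρ := by
          refine lintegral_const_mul _ (measurable_trace_exp fun p q => ?_).ennreal_ofReal
          exact (hW p q).const_add _
      _ ≤ c ^ n * (c * ENNReal.ofReal (NormedSpace.exp H).trace) := by gcongr; exact hstep H hH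
      _ = c ^ (n + 1) * ENNReal.ofReal (NormedSpace.exp H).trace := by ring

/-- Deterministic second-order bound for the exponential trace under the rank-one perturbation
`θ (u uᵀ - Δ)`; the right-hand side is affine in `u uᵀ`. -/
lemma trace_exp_add_rankOne_le [Nonempty ι] {H : Matrix ι ι ℝ} (hH : H.IsSymm) {u s : ι → ℝ}
    {M θ : ℝ} (hu : u ⬝ᵥ u ≤ M) (hs₀ : ∀ p, 0 ≤ s p) (hs : ∀ p, s p ≤ M) (hθ : |θ| * M ≤ 1) :
    (NormedSpace.exp (H + θ • (Matrix.vecMulVec u u - Matrix.diagonal s))).trace ≤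
      ((NormedSpace.exp H).trace - θ * (NormedSpace.exp H * Matrix.diagonal s).trace +
        θ ^ 2 * (NormedSpace.exp H * (Matrix.diagonal s * Matrix.diagonal s)).trace) +
      ((θ • NormedSpace.exp H + θ ^ 2 • (M • NormedSpace.exp H -
        NormedSpace.exp H * Matrix.diagonal s - Matrix.diagonal s * NormedSpace.exp H)) *
          Matrix.vecMulVec u u).trace := by
  set E := NormedSpace.exp H with hE
  set Δ := Matrix.diagonal s with hΔ
  set Y := Matrix.vecMulVec u u with hY
  have hYs : Y.IsSymm := by simp [hY, Matrix.IsSymm, Matrix.transpose_vecMulVec]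
  have hX : (θ • (Y - Δ)).IsSymm := (hYs.sub (Matrix.isSymm_diagonal s)).smul θ
  have hEpos : E.PosSemidef := hH.posSemidef_exp
  have hYpos : Y.PosSemidef := by
    simpa [hY] using Matrix.posSemidef_vecMulVec_self_star u
  have hquad : ∀ v : ι → ℝ, |v ⬝ᵥ (θ • (Y - Δ)) *ᵥ v| ≤ v ⬝ᵥ v := fun v => by
    have h1 : v ⬝ᵥ Y *ᵥ v = (u ⬝ᵥ v) ^ 2 := by
      rw [hY, Matrix.vecMulVec_mulVec, dotProduct_smul, dotProduct_comm v u]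
      simp [sq]
    have h2 : v ⬝ᵥ Δ *ᵥ v = ∑ p, s p * v p ^ 2 := by
      simp only [hΔ, dotProduct, Matrix.mulVec_diagonal]
      exact Finset.sum_congr rfl fun p _ => by ring
    have h3 : (u ⬝ᵥ v) ^ 2 ≤ M * (v ⬝ᵥ v) := by
      have hcs := Finset.sum_mul_sq_le_sq_mul_sq Finset.univ u v
      have e : ∀ w : ι → ℝ, ∑ i, w i ^ 2 = w ⬝ᵥ w := fun w => by simp [dotProduct, sq]
      rw [e, e] at hcs
      refine hcs.trans (mul_le_mul_of_nonneg_right hu ?_)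
      rw [← e]; positivity
    have h4 : ∑ p, s p * v p ^ 2 ≤ M * (v ⬝ᵥ v) := by
      rw [dotProduct, Finset.mul_sum]
      exact Finset.sum_le_sum fun p _ => by
        rw [← sq]; exact mul_le_mul_of_nonneg_right (hs p) (sq_nonneg _)
    have h5 : 0 ≤ ∑ p, s p * v p ^ 2 :=
      Finset.sum_nonneg fun p _ => mul_nonneg (hs₀ p) (sq_nonneg _)
    have h6 : 0 ≤ v ⬝ᵥ v := by
      simpa [dotProduct] using Finset.sum_nonneg fun i _ => mul_self_nonneg (v i)
    rw [Matrix.smul_mulVec, dotProduct_smul, Matrix.sub_mulVec, dotProduct_sub, h1, h2,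
      smul_eq_mul, abs_mul]
    have h7 : |(u ⬝ᵥ v) ^ 2 - ∑ p, s p * v p ^ 2| ≤ M * (v ⬝ᵥ v) :=
      abs_le.2 ⟨by nlinarith [sq_nonneg (u ⬝ᵥ v)], by linarith⟩
    calc |θ| * |(u ⬝ᵥ v) ^ 2 - ∑ p, s p * v p ^ 2| ≤ |θ| * (M * (v ⬝ᵥ v)) := by gcongr
      _ = |θ| * M * (v ⬝ᵥ v) := by ring
      _ ≤ v ⬝ᵥ v := mul_le_of_le_one_left h6 hθ
  have hGT := trace_exp_add_le hH hX
  have hexp := hEpos.trace_mul_nonneg (posSemidef_one_add_add_sq_sub_exp hX hquad)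
  have hYY : Y * Y = (u ⬝ᵥ u) • Y := by
    rw [hY, Matrix.vecMulVec_mul_vecMulVec]
    simp [Matrix.vecMulVec_smul]
  have hEY : (u ⬝ᵥ u) * (E * Y).trace ≤ M * (E * Y).trace :=
    mul_le_mul_of_nonneg_right hu (hEpos.trace_mul_nonneg hYpos)
  have hexpand : (E * (1 + θ • (Y - Δ) + θ • (Y - Δ) * θ • (Y - Δ) -
      NormedSpace.exp (θ • (Y - Δ)))).trace =
      E.trace + θ * ((E * Y).trace - (E * Δ).trace) + θ ^ 2 * ((u ⬝ᵥ u) * (E * Y).trace -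
        (E * (Y * Δ)).trace - (E * (Δ * Y)).trace + (E * (Δ * Δ)).trace) -
        (E * NormedSpace.exp (θ • (Y - Δ))).trace := by
    rw [Matrix.smul_mul, Matrix.mul_smul, smul_smul, sub_mul, mul_sub, mul_sub, hYY]
    simp only [mul_sub, mul_add, mul_one, Matrix.mul_smul, Matrix.trace_add, Matrix.trace_sub,
      Matrix.trace_smul, smul_eq_mul]
    ring
  have hcyc : (Δ * E * Y).trace = (E * (Y * Δ)).trace := by
    rw [mul_assoc, Matrix.trace_mul_comm, mul_assoc]
  have hrhs : ((θ • E + θ ^ 2 • (M • E - E * Δ - Δ * E)) * Y).trace =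
      θ * (E * Y).trace + θ ^ 2 * (M * (E * Y).trace - (E * (Δ * Y)).trace -
        (E * (Y * Δ)).trace) := by
    rw [← hcyc]
    simp only [add_mul, sub_mul, Matrix.smul_mul, Matrix.trace_add, Matrix.trace_sub,
      Matrix.trace_smul, smul_eq_mul, mul_assoc]
  rw [hexpand] at hexp
  rw [hrhs]
  nlinarith [mul_le_mul_of_nonneg_left hEY (sq_nonneg θ)]

/-- The one-step exponential trace moment bound for centered rank-one matrices. -/
lemma lintegral_trace_exp_add_rankOne_le [Nonempty ι] [IsProbabilityMeasure ρ]
    {u : Ω → ι → ℝ} {s : ι → ℝ} {M σ θ : ℝ}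
    (hint : ∀ p q, Integrable (fun z => u z p * u z q) ρ)
    (hmean : ∀ p q, ∫ z, u z p * u z q ∂ρ = Matrix.diagonal s p q)
    (hu : ∀ z, u z ⬝ᵥ u z ≤ M) (hs₀ : ∀ p, 0 ≤ s p) (hs : ∀ p, s p ≤ M) (hσ : ∀ p, s p ≤ σ)
    (hθ : |θ| * M ≤ 1) {H : Matrix ι ι ℝ} (hH : H.IsSymm) :
    ∫⁻ z, ENNReal.ofReal (NormedSpace.exp
        (H + θ • (Matrix.vecMulVec (u z) (u z) - Matrix.diagonal s))).trace ∂ρ ≤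
      ENNReal.ofReal (Real.exp (θ ^ 2 * (σ * M))) *
        ENNReal.ofReal (NormedSpace.exp H).trace := by
  set E := NormedSpace.exp H with hE
  set Δ := Matrix.diagonal s with hΔ
  set c : ℝ := E.trace - θ * (E * Δ).trace + θ ^ 2 * (E * (Δ * Δ)).trace with hc
  set G := θ • E + θ ^ 2 • (M • E - E * Δ - Δ * E) with hG
  have hpt : ∀ z, (NormedSpace.exp (H + θ • (Matrix.vecMulVec (u z) (u z) - Δ))).trace ≤
      c + (G * Matrix.vecMulVec (u z) (u z)).trace := fun z =>
    trace_exp_add_rankOne_le hH (hu z) hs₀ hs hθ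
  have hsymm : ∀ z, (H + θ • (Matrix.vecMulVec (u z) (u z) - Δ)).IsSymm := fun z =>
    hH.add (IsSymm.smul (IsSymm.sub (by simp [Matrix.IsSymm, Matrix.transpose_vecMulVec])
      (Matrix.isSymm_diagonal s)) θ)
  have hnn : ∀ z, 0 ≤ c + (G * Matrix.vecMulVec (u z) (u z)).trace := fun z =>
    ((hsymm z).posSemidef_exp.trace_nonneg).trans (hpt z)
  have hint' : ∀ p q, Integrable (fun z => Matrix.vecMulVec (u z) (u z) p q) ρ := hint
  have hI := integrable_trace_mul G hint'
  have hM : 0 ≤ M := (hs₀ (Classical.arbitrary ι)).trans (hs _)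
  have hEpos : E.PosSemidef := hH.posSemidef_exp
  have hmeanle : c + (G * Δ).trace ≤ Real.exp (θ ^ 2 * (σ * M)) * E.trace := by
    have hcyc : (Δ * E * Δ).trace = (E * (Δ * Δ)).trace := by
      rw [mul_assoc, Matrix.trace_mul_comm, mul_assoc]
    have e : c + (G * Δ).trace = E.trace + θ ^ 2 * (M * (E * Δ).trace - (E * (Δ * Δ)).trace) := by
      rw [hc, hG]
      simp only [add_mul, sub_mul, Matrix.smul_mul, Matrix.trace_add, Matrix.trace_sub,
        Matrix.trace_smul, smul_eq_mul, hcyc]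
      rw [mul_assoc E]
      ring
    have h₁ : 0 ≤ (E * (Δ * Δ)).trace := hEpos.trace_mul_nonneg (by
      rw [hΔ, Matrix.diagonal_mul_diagonal]
      exact Matrix.PosSemidef.diagonal fun p => mul_self_nonneg (s p))
    have h₂ : (E * Δ).trace ≤ σ * E.trace := by
      simp only [hΔ, Matrix.trace, Matrix.diag_apply, Matrix.mul_diagonal, Finset.mul_sum]
      exact Finset.sum_le_sum fun p _ => by
        rw [mul_comm]; exact mul_le_mul_of_nonneg_right (hσ p) hEpos.diag_nonneg
    have h₃ : θ ^ 2 * (M * (E * Δ).trace - (E * (Δ * Δ)).trace) ≤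
        θ ^ 2 * (σ * M) * E.trace := by
      rw [mul_assoc]
      exact mul_le_mul_of_nonneg_left (by nlinarith) (sq_nonneg θ)
    rw [e]
    nlinarith [mul_le_mul_of_nonneg_right (Real.add_one_le_exp (θ ^ 2 * (σ * M)))
      hEpos.trace_nonneg]
  calc ∫⁻ z, ENNReal.ofReal (NormedSpace.exp
        (H + θ • (Matrix.vecMulVec (u z) (u z) - Δ))).trace ∂ρ
      ≤ ∫⁻ z, ENNReal.ofReal (c + (G * Matrix.vecMulVec (u z) (u z)).trace) ∂ρ :=
        lintegral_mono fun z => ENNReal.ofReal_le_ofReal (hpt z)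
    _ = ENNReal.ofReal (∫ z, c + (G * Matrix.vecMulVec (u z) (u z)).trace ∂ρ) :=
        (ofReal_integral_eq_lintegral_ofReal ((integrable_const c).add hI)
          (Filter.Eventually.of_forall hnn)).symm
    _ = ENNReal.ofReal (c + (G * Δ).trace) := by
        rw [integral_add (integrable_const c) hI, integral_trace_mul G hint' hmean]
        simp
    _ ≤ ENNReal.ofReal (Real.exp (θ ^ 2 * (σ * M)) * E.trace) := ENNReal.ofReal_le_ofReal hmeanle
    _ = _ := ENNReal.ofReal_mul (Real.exp_pos _).le

open scoped Matrix.Norms.L2Operator in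
/-- **Matrix Bernstein inequality** for sums of independent centered rank-one matrices, in
exponential form. -/
lemma measure_lt_norm_sum_rankOne_le [Nonempty ι] [IsProbabilityMeasure ρ]
    {u : Ω → ι → ℝ} {s : ι → ℝ} {M σ θ : ℝ} (hmeas : ∀ p, Measurable fun z => u z p)
    (hint : ∀ p q, Integrable (fun z => u z p * u z q) ρ)
    (hmean : ∀ p q, ∫ z, u z p * u z q ∂ρ = Matrix.diagonal s p q)
    (hu : ∀ z, u z ⬝ᵥ u z ≤ M) (hs₀ : ∀ p, 0 ≤ s p) (hs : ∀ p, s p ≤ M) (hσ : ∀ p, s p ≤ σ)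
    (hθ₀ : 0 ≤ θ) (hθ : θ * M ≤ 1) (n : ℕ) (t : ℝ) :
    ∃ B : Set (Fin n → Ω), MeasurableSet B ∧
      (Measure.pi fun _ : Fin n => ρ) B ≤
        ENNReal.ofReal (2 * Fintype.card ι * Real.exp (n * (θ ^ 2 * (σ * M)) - θ * t)) ∧
      ∀ x, t < ‖∑ j, (Matrix.vecMulVec (u (x j)) (u (x j)) - Matrix.diagonal s)‖ → x ∈ B := by
  set Y : Ω → Matrix ι ι ℝ := fun z => Matrix.vecMulVec (u z) (u z) - Matrix.diagonal s with hY
  set μ := Measure.pi fun _ : Fin n => ρ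
  have hYm : ∀ p q, Measurable fun z => Y z p q := fun p q =>
    ((hmeas p).mul (hmeas q)).sub_const _
  have hYs : ∀ z, (Y z).IsSymm := fun z =>
    IsSymm.sub (by simp [Matrix.IsSymm, Matrix.transpose_vecMulVec]) (Matrix.isSymm_diagonal s)
  set F : ℝ → (Fin n → Ω) → ℝ := fun η x => (NormedSpace.exp (η • ∑ j, Y (x j))).trace with hF
  have hSs : ∀ x : Fin n → Ω, (∑ j, Y (x j)).IsSymm := fun x => by
    simp only [Matrix.IsSymm, Matrix.transpose_sum, (hYs _).eq]
  have hFm : ∀ η, Measurable (F η) := fun η => measurable_trace_exp fun p q => by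
    simp only [Matrix.smul_apply, Matrix.sum_apply]
    exact (Finset.measurable_sum _ fun j _ => (hYm p q).comp (measurable_pi_apply j)).const_smul η
  have hF0 : ∀ η x, 0 ≤ F η x := fun η x => ((hSs x).smul η).posSemidef_exp.trace_nonneg
  have hFint : ∀ η, η ^ 2 = θ ^ 2 → |η| * M ≤ 1 → ∫⁻ x, ENNReal.ofReal (F η x) ∂μ ≤
      ENNReal.ofReal (Fintype.card ι * Real.exp (n * (θ ^ 2 * (σ * M)))) := fun η hη hηM => by
    have h := lintegral_trace_exp_add_sum_le (ρ := ρ) (W := fun z => η • Y z)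
      (fun p q => (hYm p q).const_smul η) (fun z => (hYs z).smul η)
      (fun H hH => lintegral_trace_exp_add_rankOne_le hint hmean hu hs₀ hs hσ hηM hH) n 0
      Matrix.isSymm_zero
    simp only [zero_add, NormedSpace.exp_zero, Matrix.trace_one, ← Finset.smul_sum] at h
    refine h.trans_eq ?_
    rw [← ENNReal.ofReal_pow (Real.exp_pos _).le, ← ENNReal.ofReal_mul (by positivity), hη,
      ← Real.exp_nat_mul, mul_comm]
  refine ⟨{x | ENNReal.ofReal (Real.exp (θ * t)) ≤ ENNReal.ofReal (F θ x + F (-θ) x)}, ?_, ?_, ?_⟩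
  · exact measurableSet_le measurable_const ((hFm θ).add (hFm (-θ))).ennreal_ofReal
  · have hmk := mul_meas_ge_le_lintegral (μ := μ) ((hFm θ).add (hFm (-θ))).ennreal_ofReal
      (ENNReal.ofReal (Real.exp (θ * t)))
    have hsum : ∫⁻ x, ENNReal.ofReal (F θ x + F (-θ) x) ∂μ ≤
        ENNReal.ofReal (2 * Fintype.card ι * Real.exp (n * (θ ^ 2 * (σ * M)))) := by
      calc ∫⁻ x, ENNReal.ofReal (F θ x + F (-θ) x) ∂μ
          = ∫⁻ x, ENNReal.ofReal (F θ x) ∂μ + ∫⁻ x, ENNReal.ofReal (F (-θ) x) ∂μ := by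
            rw [← lintegral_add_left (hFm θ).ennreal_ofReal]
            exact lintegral_congr fun x => ENNReal.ofReal_add (hF0 _ _) (hF0 _ _)
        _ ≤ _ := add_le_add (hFint θ rfl (by rwa [abs_of_nonneg hθ₀]))
            (hFint (-θ) (neg_sq θ) (by rwa [abs_neg, abs_of_nonneg hθ₀]))
        _ = _ := by
            rw [← ENNReal.ofReal_add (by positivity) (by positivity)]
            congr 1; ring
    have hpos : 0 < ENNReal.ofReal (Real.exp (θ * t)) := ENNReal.ofReal_pos.2 (Real.exp_pos _)
    rw [← ENNReal.mul_le_mul_iff_right hpos.ne' ENNReal.ofReal_ne_top]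
    refine (hmk.trans hsum).trans_eq ?_
    rw [← ENNReal.ofReal_mul (Real.exp_pos _).le, Real.exp_sub]
    congr 1
    field_simp
  · intro x hx
    refine ENNReal.ofReal_le_ofReal (le_trans ?_ (exp_mul_norm_le_trace_exp_add (hSs x)))
    exact Real.exp_le_exp.2 (mul_le_mul_of_nonneg_left hx.le hθ₀)

end Probability

/-- **Weighted matrix Bernstein concentration of ΦᵀΦ around nI (Lemma C.5).**
There is an absolute constant C₀ such that for orthonormal features φ₁,…,φ_R bounded by
b₁,…,b_R and positive weights d₁,…,d_R, with probability at least 1 − δ over n i.i.d.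
samples, the spectral norm of D(ΦᵀΦ − nI)D is at most
C₀ max{ √(n d_max² M log(2R/δ)), M log(2R/δ) }, where M = max{Σ d_p² b_p², d_max²}. -/
theorem statement_12 :
    ∃ C₀ : ℝ, 0 < C₀ ∧
      ∀ (Ω : Type*) (_ : MeasurableSpace Ω) (ρ : Measure Ω), IsProbabilityMeasure ρ →
        ∀ R : ℕ, 1 ≤ R →
        ∀ φ : Fin R → Ω → ℝ, (∀ p, Measurable (φ p)) →
        ∀ b : Fin R → ℝ, (∀ p z, |φ p z| ≤ b p) →
        (∀ p q, ∫ z, φ p z * φ q z ∂ρ = if p = q then 1 else 0) →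
        ∀ d : Fin R → ℝ, (∀ p, 0 < d p) →
        ∀ n : ℕ, 1 ≤ n → ∀ δ : ℝ, 0 < δ → δ < 1 →
        ENNReal.ofReal (1 - δ) ≤
          (Measure.pi fun _ : Fin n => ρ)
            {x : Fin n → Ω |
              opNorm (Matrix.diagonal d *
                  ((Matrix.of fun (j : Fin n) (p : Fin R) => φ p (x j))ᵀ *
                      (Matrix.of fun (j : Fin n) (p : Fin R) => φ p (x j)) -
                    (n : ℝ) • (1 : Matrix (Fin R) (Fin R) ℝ)) *
                Matrix.diagonal d) ≤
              C₀ * max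
                (Real.sqrt ((n : ℝ) * (⨆ p, d p) ^ 2 *
                  (max (∑ p, d p ^ 2 * b p ^ 2) ((⨆ p, d p) ^ 2)) *
                  Real.log (2 * R / δ)))
                ((max (∑ p, d p ^ 2 * b p ^ 2) ((⨆ p, d p) ^ 2)) *
                  Real.log (2 * R / δ))} := by
  refine ⟨2, two_pos, ?_⟩
  intro Ω _ ρ _ R hR φ hφ b hb horth d hd n _ δ hδ hδ1
  have : Nonempty (Fin R) := ⟨⟨0, hR⟩⟩
  set m := ⨆ p, d p
  set M := max (∑ p, d p ^ 2 * b p ^ 2) (m ^ 2) with hM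
  set L := Real.log (2 * R / δ) with hL
  set T := max (Real.sqrt (n * m ^ 2 * M * L)) (M * L) with hT
  have hdm : ∀ p, d p ≤ m := fun p => le_ciSup (Set.finite_range d).bddAbove p
  have hm : 0 < m := (hd ⟨0, hR⟩).trans_le (hdm _)
  have hM0 : 0 < M := (pow_pos hm 2).trans_le (le_max_right _ _)
  have hR1 : (1 : ℝ) ≤ R := by exact_mod_cast hR
  have hL0 : 0 < L := Real.log_pos (by rw [lt_div_iff₀ hδ]; linarith)
  have hT1 : M * L ≤ T := le_max_right _ _
  have hT0 : 0 < T := (mul_pos hM0 hL0).trans_le hT1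
  have hT2 : n * m ^ 2 * M * L ≤ T ^ 2 := by
    have h : 0 ≤ n * m ^ 2 * M * L := by positivity
    rw [← Real.sq_sqrt h]
    exact pow_le_pow_left₀ (Real.sqrt_nonneg _) (le_max_left _ _) 2
  set u : Ω → Fin R → ℝ := fun z p => d p * φ p z with hu
  have hbd : ∀ p q z, ‖φ p z * φ q z‖ ≤ b p * b q := fun p q z => by
    rw [norm_mul]
    exact mul_le_mul (hb p z) (hb q z) (norm_nonneg _) ((abs_nonneg _).trans (hb p z))
  have hφint : ∀ p q, Integrable (fun z => φ p z * φ q z) ρ := fun p q =>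
    Integrable.of_bound ((hφ p).mul (hφ q)).aestronglyMeasurable (b p * b q)
      (Filter.Eventually.of_forall (hbd p q))
  have hprod : ∀ p q z, u z p * u z q = d p * d q * (φ p z * φ q z) := fun p q z => by
    simp only [hu]; ring
  have hθM : L / T * M ≤ 1 := by
    rw [div_mul_eq_mul_div, div_le_one hT0, mul_comm]; exact hT1
  obtain ⟨B, hBm, hB, hmem⟩ := measure_lt_norm_sum_rankOne_le (ρ := ρ) (u := u)
    (s := fun p => d p ^ 2) (M := M) (σ := m ^ 2) (θ := L / T)
    (fun p => (hφ p).const_mul (d p))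
    (fun p q => by simp only [hprod]; exact (hφint p q).const_mul _)
    (fun p q => by
      simp only [hprod]
      rw [integral_const_mul, horth, Matrix.diagonal_apply]
      split_ifs with h
      · rw [h]; ring
      · simp)
    (fun z => by
      refine le_trans (Finset.sum_le_sum fun p _ => ?_) (le_max_left _ _)
      rw [← sq, mul_pow]
      exact mul_le_mul_of_nonneg_left (sq_le_sq' (abs_le.1 (hb p z)).1 (abs_le.1 (hb p z)).2)
        (sq_nonneg _))
    (fun p => sq_nonneg _)
    (fun p => (pow_le_pow_left₀ (hd p).le (hdm p) 2).trans (le_max_right _ _))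
    (fun p => pow_le_pow_left₀ (hd p).le (hdm p) 2) (by positivity) hθM n (2 * T)
  have hBδ : (Measure.pi fun _ : Fin n => ρ) B ≤ ENNReal.ofReal δ := by
    refine hB.trans (ENNReal.ofReal_le_ofReal ?_)
    have h₁ : n * ((L / T) ^ 2 * (m ^ 2 * M)) - L / T * (2 * T) ≤ -L := by
      have e : n * ((L / T) ^ 2 * (m ^ 2 * M)) = L * ((n * m ^ 2 * M * L) / T ^ 2) := by
        field_simp
      have e' : L / T * (2 * T) = 2 * L := by field_simp
      have h : (n * m ^ 2 * M * L) / T ^ 2 ≤ 1 := div_le_one_of_le₀ hT2 (sq_nonneg _)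
      rw [e, e']
      nlinarith
    calc 2 * (Fintype.card (Fin R) : ℝ) *
          Real.exp (n * ((L / T) ^ 2 * (m ^ 2 * M)) - L / T * (2 * T))
        ≤ 2 * R * Real.exp (-L) := by
          rw [Fintype.card_fin]; gcongr
      _ = δ := by
          rw [Real.exp_neg, hL, Real.exp_log (by positivity)]
          field_simp
  have hsum : ∀ x : Fin n → Ω, Matrix.diagonal d *
      ((Matrix.of fun (j : Fin n) (p : Fin R) => φ p (x j))ᵀ *
          (Matrix.of fun (j : Fin n) (p : Fin R) => φ p (x j)) -
        (n : ℝ) • (1 : Matrix (Fin R) (Fin R) ℝ)) * Matrix.diagonal d =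
      ∑ j, (Matrix.vecMulVec (u (x j)) (u (x j)) - Matrix.diagonal fun p => d p ^ 2) := fun x => by
    ext p q
    rw [Matrix.mul_diagonal, Matrix.diagonal_mul, Matrix.sum_apply]
    simp only [Matrix.sub_apply, Matrix.mul_apply, Matrix.transpose_apply, Matrix.of_apply,
      Matrix.smul_apply, Matrix.one_apply, Matrix.vecMulVec_apply, Matrix.diagonal_apply,
      Finset.sum_sub_distrib, hprod, ← Finset.mul_sum, Finset.sum_const, Finset.card_univ,
      Fintype.card_fin, nsmul_eq_mul, smul_eq_mul]
    split_ifs with h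
    · subst h; ring
    · ring
  calc ENNReal.ofReal (1 - δ) = 1 - ENNReal.ofReal δ := by
        rw [ENNReal.ofReal_sub _ hδ.le, ENNReal.ofReal_one]
    _ ≤ 1 - (Measure.pi fun _ : Fin n => ρ) B := tsub_le_tsub_left hBδ 1
    _ = (Measure.pi fun _ : Fin n => ρ) Bᶜ := (prob_compl_eq_one_sub hBm).symm
    _ ≤ _ := measure_mono fun x hx => by
        rw [Set.mem_ofPred_eq, hsum]
        exact not_lt.1 fun h => hx (hmem x h)
end
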